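/- arXiv:1611.04929 — 3 statements merged into one kernel-verified Lean document; each statement's English description precedes it below -/
import Mathlib

section
/- Let e = [a₁, b₁] × [a₂, b₂] ⊂ ℝ² be a closed rectangle and let u, w : ℝ² → ℝ² be continuously differentiable on a neighbourhood of e. Then ∫ₑ w·((∇⊥·u) u⊥) dx dz = −∫ₑ ∇⊥(w·u⊥)·u dx dz + ∫_{∂e} (n⊥·u)(w·u⊥) dS, where n is the outward unit normal on ∂e and n⊥ = (−n₂, n₁). -/
open MeasureTheory

/-- Partial derivative in the `x`-direction of a scalar field on the vertical slice. -/
noncomputable def pdx (g : ℝ × ℝ → ℝ) (p : ℝ × ℝ) : ℝ := fderiv ℝ g p (1, 0)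

/-- Partial derivative in the `z`-direction of a scalar field on the vertical slice. -/
noncomputable def pdz (g : ℝ × ℝ → ℝ) (p : ℝ × ℝ) : ℝ := fderiv ℝ g p (0, 1)

/-- A directional derivative of a continuously differentiable function is continuous. -/
theorem ContDiffOn.continuousOn_fderiv_apply_const {f : ℝ × ℝ → ℝ} {U : Set (ℝ × ℝ)}
    (hf : ContDiffOn ℝ 1 f U) (hU : IsOpen U) (v : ℝ × ℝ) :
    ContinuousOn (fun p => fderiv ℝ f p v) U :=
  (hf.continuousOn_fderiv_of_isOpen hU le_rfl).clm_apply continuousOn_const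

/-- Integration by parts on a rectangle, for the rotated gradient of a scalar field `g` against a
vector field with components `u₁` and `u₂`. -/
theorem integral_Icc_curl_mul (a₁ b₁ a₂ b₂ : ℝ) (hab₁ : a₁ ≤ b₁) (hab₂ : a₂ ≤ b₂)
    {u₁ u₂ g : ℝ × ℝ → ℝ} {U : Set (ℝ × ℝ)} (hU : IsOpen U)
    (heU : Set.Icc (a₁, a₂) (b₁, b₂) ⊆ U) (hu₁ : ContDiffOn ℝ 1 u₁ U)
    (hu₂ : ContDiffOn ℝ 1 u₂ U) (hg : ContDiffOn ℝ 1 g U) :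
    ∫ p in Set.Icc (a₁, a₂) (b₁, b₂), (pdx u₂ p - pdz u₁ p) * g p
      = -(∫ p in Set.Icc (a₁, a₂) (b₁, b₂), (-(pdz g p) * u₁ p + pdx g p * u₂ p))
        + (((∫ z in a₂..b₂, u₂ (b₁, z) * g (b₁, z)) - ∫ z in a₂..b₂, u₂ (a₁, z) * g (a₁, z))
          - ((∫ x in a₁..b₁, u₁ (x, b₂) * g (x, b₂))
              - ∫ x in a₁..b₁, u₁ (x, a₂) * g (x, a₂))) := by
  have hd {f : ℝ × ℝ → ℝ} (hf : ContDiffOn ℝ 1 f U) {p : ℝ × ℝ}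
      (hp : p ∈ Set.Ioo a₁ b₁ ×ˢ Set.Ioo a₂ b₂) : HasFDerivAt f (fderiv ℝ f p) p :=
    ((hf.differentiableOn one_ne_zero).differentiableAt (hU.mem_nhds
      (heU ⟨⟨hp.1.1.le, hp.2.1.le⟩, ⟨hp.1.2.le, hp.2.2.le⟩⟩))).hasFDerivAt
  have hint {f : ℝ × ℝ → ℝ} (hf : ContinuousOn f U) :
      IntegrableOn f (Set.Icc (a₁, a₂) (b₁, b₂)) :=
    (hf.mono heU).integrableOn_compact isCompact_Icc
  have hi₁ : IntegrableOn (fun p => (pdx u₂ p - pdz u₁ p) * g p)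
      (Set.Icc (a₁, a₂) (b₁, b₂)) :=
    hint (((hu₂.continuousOn_fderiv_apply_const hU _).sub
      (hu₁.continuousOn_fderiv_apply_const hU _)).mul hg.continuousOn)
  have hi₂ : IntegrableOn (fun p => -(pdz g p) * u₁ p + pdx g p * u₂ p)
      (Set.Icc (a₁, a₂) (b₁, b₂)) :=
    hint (((hg.continuousOn_fderiv_apply_const hU _).neg.mul hu₁.continuousOn).add
      ((hg.continuousOn_fderiv_apply_const hU _).mul hu₂.continuousOn))
  have heq (p : ℝ × ℝ) :
      (u₂ p • fderiv ℝ g p + g p • fderiv ℝ u₂ p) (1, 0)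
          + (-(u₁ p • fderiv ℝ g p + g p • fderiv ℝ u₁ p)) (0, 1)
        = (pdx u₂ p - pdz u₁ p) * g p + (-(pdz g p) * u₁ p + pdx g p * u₂ p) := by
    simp only [pdx, pdz, add_apply, neg_apply,
      smul_apply, smul_eq_mul]
    ring
  have key := integral_divergence_prod_Icc_of_hasFDerivAt_of_le
    (fun p => u₂ p * g p) (fun p => -(u₁ p * g p))
    (fun p => u₂ p • fderiv ℝ g p + g p • fderiv ℝ u₂ p)
    (fun p => -(u₁ p • fderiv ℝ g p + g p • fderiv ℝ u₁ p))
    (a₁, a₂) (b₁, b₂) ⟨hab₁, hab₂⟩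
    ((hu₂.continuousOn.mul hg.continuousOn).mono heU)
    ((hu₁.continuousOn.mul hg.continuousOn).neg.mono heU)
    (fun p hp => (hd hu₂ hp).mul (hd hg hp))
    (fun p hp => ((hd hu₁ hp).mul (hd hg hp)).neg)
    (by simp only [heq]; exact hi₁.add hi₂)
  simp only [heq, intervalIntegral.integral_neg] at key
  rw [integral_add hi₁ hi₂] at key
  linarith

/-- Integration by parts of the vector-invariant advection term over a closed rectangle
`e = [a₁,b₁] × [a₂,b₂]`:
`∫ₑ w·((∇⊥·u) u⊥) = −∫ₑ ∇⊥(w·u⊥)·u + ∫_{∂e} (n⊥·u)(w·u⊥) dS`,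
where `g = w·u⊥`, and the boundary integral is written out over the four sides of the
rectangle with outward unit normal `n` and `n⊥ = (−n₂, n₁)` (so `n⊥·u` equals `u₁`, `−u₁`,
`−u₂`, `u₂` on the bottom, top, left and right sides respectively). -/
theorem rectangle_integration_by_parts
    (a₁ b₁ a₂ b₂ : ℝ) (hab₁ : a₁ ≤ b₁) (hab₂ : a₂ ≤ b₂)
    (u w : ℝ × ℝ → ℝ × ℝ)
    (U : Set (ℝ × ℝ)) (hU : IsOpen U) (heU : Set.Icc (a₁, a₂) (b₁, b₂) ⊆ U)
    (hu : ContDiffOn ℝ 1 u U) (hw : ContDiffOn ℝ 1 w U)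
    (g : ℝ × ℝ → ℝ) (hg : g = fun r => -(w r).1 * (u r).2 + (w r).2 * (u r).1) :
    ∫ p in Set.Icc (a₁, a₂) (b₁, b₂),
        (pdx (fun r => (u r).2) p - pdz (fun r => (u r).1) p) * g p
      = -(∫ p in Set.Icc (a₁, a₂) (b₁, b₂),
            (-(pdz g p) * (u p).1 + pdx g p * (u p).2))
        + (((∫ z in a₂..b₂, (u (b₁, z)).2 * g (b₁, z))
              - ∫ z in a₂..b₂, (u (a₁, z)).2 * g (a₁, z))
          - ((∫ x in a₁..b₁, (u (x, b₂)).1 * g (x, b₂))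
              - ∫ x in a₁..b₁, (u (x, a₂)).1 * g (x, a₂))) := by
  have hg' : ContDiffOn ℝ 1 g U := by
    rw [hg]
    exact (hw.fst.neg.mul hu.snd).add (hw.snd.mul hu.fst)
  exact integral_Icc_curl_mul a₁ b₁ a₂ b₂ hab₁ hab₂ hU heU hu.fst hu.snd hg'
end

section
/- Suppose (u, v, b, p) is a smooth solution of the Eady–Boussinesq vertical slice equations on Ω for t in an open interval I. Then the in-slice kinetic energy K_u is differentiable on I and dK_u/dt (t) = ρ₀ ∫_Ω ( f v u₁ + b u₂ ) dx dz for every t ∈ I. -/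
open MeasureTheory

/-- The vertical slice domain `Ω = [−L, L] × [0, H]`. -/
def Omega (L H : ℝ) : Set (ℝ × ℝ) := Set.Icc (-L, 0) (L, H)

/-- A smooth solution of the Eady–Boussinesq vertical slice equations on `Ω = [−L,L]×[0,H]`
for times `t ∈ I`, with constants `ρ₀` (reference density), `f` (Coriolis parameter),
`N2` (squared Brunt–Väisälä frequency) and `bY = ∂b̄/∂y` (constant background buoyancy
gradient).  All fields are smooth, `2L`-periodic in `x`, and the in-slice velocity
satisfies the rigid-lid conditions `u₂ = 0` at `z = 0` and `z = H`. -/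
structure EadySolution (L H ρ₀ f N2 bY : ℝ) (I : Set ℝ) where
  /-- in-slice velocity `u = (u₁, u₂)`, a function of time and of the point `(x, z)` -/
  u : ℝ → ℝ × ℝ → ℝ × ℝ
  /-- out-of-slice velocity `v` -/
  v : ℝ → ℝ × ℝ → ℝ
  /-- buoyancy `b` -/
  b : ℝ → ℝ × ℝ → ℝ
  /-- pressure `p` -/
  p : ℝ → ℝ × ℝ → ℝ
  smooth_u : ContDiff ℝ (⊤ : ℕ∞) fun q : ℝ × (ℝ × ℝ) => u q.1 q.2
  smooth_v : ContDiff ℝ (⊤ : ℕ∞) fun q : ℝ × (ℝ × ℝ) => v q.1 q.2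
  smooth_b : ContDiff ℝ (⊤ : ℕ∞) fun q : ℝ × (ℝ × ℝ) => b q.1 q.2
  smooth_p : ContDiff ℝ (⊤ : ℕ∞) fun q : ℝ × (ℝ × ℝ) => p q.1 q.2
  periodic_u : ∀ t x z : ℝ, u t (x + 2 * L, z) = u t (x, z)
  periodic_v : ∀ t x z : ℝ, v t (x + 2 * L, z) = v t (x, z)
  periodic_b : ∀ t x z : ℝ, b t (x + 2 * L, z) = b t (x, z)
  periodic_p : ∀ t x z : ℝ, p t (x + 2 * L, z) = p t (x, z)
  /-- rigid lid on the lower boundary: `u·ẑ = 0` at `z = 0` -/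
  rigid_bot : ∀ t x : ℝ, (u t (x, 0)).2 = 0
  /-- rigid lid on the upper boundary: `u·ẑ = 0` at `z = H` -/
  rigid_top : ∀ t x : ℝ, (u t (x, H)).2 = 0
  /-- `x̂`-component of `∂u/∂t + (u·∇)u − f v x̂ = −(1/ρ₀)∇p + b ẑ` -/
  mom_x : ∀ t ∈ I, ∀ pt ∈ Omega L H,
    deriv (fun s => (u s pt).1) t
      + (u t pt).1 * pdx (fun q => (u t q).1) pt
      + (u t pt).2 * pdz (fun q => (u t q).1) pt
      - f * v t pt
    = -(1 / ρ₀) * pdx (p t) pt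
  /-- `ẑ`-component of `∂u/∂t + (u·∇)u − f v x̂ = −(1/ρ₀)∇p + b ẑ` -/
  mom_z : ∀ t ∈ I, ∀ pt ∈ Omega L H,
    deriv (fun s => (u s pt).2) t
      + (u t pt).1 * pdx (fun q => (u t q).2) pt
      + (u t pt).2 * pdz (fun q => (u t q).2) pt
    = -(1 / ρ₀) * pdz (p t) pt + b t pt
  /-- `∂v/∂t + u·∇v + f u₁ = −b̄_y (z − H/2)` -/
  mom_v : ∀ t ∈ I, ∀ pt ∈ Omega L H,
    deriv (fun s => v s pt) t
      + (u t pt).1 * pdx (v t) pt + (u t pt).2 * pdz (v t) pt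
      + f * (u t pt).1
    = -bY * (pt.2 - H / 2)
  /-- `∂b/∂t + u·∇b + b̄_y v + N² u₂ = 0` -/
  buoy : ∀ t ∈ I, ∀ pt ∈ Omega L H,
    deriv (fun s => b s pt) t
      + (u t pt).1 * pdx (b t) pt + (u t pt).2 * pdz (b t) pt
      + bY * v t pt + N2 * (u t pt).2
    = 0
  /-- incompressibility `∇·u = 0` -/
  incomp : ∀ t ∈ I, ∀ pt ∈ Omega L H,
    pdx (fun q => (u t q).1) pt + pdz (fun q => (u t q).2) pt = 0

/-- In-slice kinetic energy `K_u(t) = ρ₀ ∫_Ω ½|u|² dx dz`. -/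
noncomputable def Ku (L H ρ₀ : ℝ) (u : ℝ → ℝ × ℝ → ℝ × ℝ) (t : ℝ) : ℝ :=
  ρ₀ * ∫ pt in Omega L H, (1 / 2) * ((u t pt).1 ^ 2 + (u t pt).2 ^ 2)

/-- Out-of-slice kinetic energy `K_v(t) = ρ₀ ∫_Ω ½ v² dx dz`. -/
noncomputable def Kv (L H ρ₀ : ℝ) (v : ℝ → ℝ × ℝ → ℝ) (t : ℝ) : ℝ :=
  ρ₀ * ∫ pt in Omega L H, (1 / 2) * (v t pt) ^ 2

/-- Potential energy `P(t) = −ρ₀ ∫_Ω b (z − H/2) dx dz`. -/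
noncomputable def Pe (L H ρ₀ : ℝ) (b : ℝ → ℝ × ℝ → ℝ) (t : ℝ) : ℝ :=
  -(ρ₀ * ∫ pt in Omega L H, b t pt * (pt.2 - H / 2))

/-- Differentiation under the integral sign over a compact set, for a jointly `C¹` integrand. -/
theorem hasDerivAt_setIntegral_of_contDiff {V : Type*} [NormedAddCommGroup V] [NormedSpace ℝ V]
    [MeasurableSpace V] [BorelSpace V] {μ : Measure V} [IsFiniteMeasureOnCompacts μ]
    {K : Set V} (hK : IsCompact K) {F : ℝ → V → ℝ}
    (hF : ContDiff ℝ 1 fun q : ℝ × V => F q.1 q.2) (t : ℝ) :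
    HasDerivAt (fun s => ∫ x in K, F s x ∂μ) (∫ x in K, deriv (fun s => F s x) t ∂μ) t := by
  have hd : ∀ s x, HasDerivAt (fun s => F s x)
      (fderiv ℝ (fun q : ℝ × V => F q.1 q.2) (s, x) (1, 0)) s := fun s x =>
    ((hF.differentiable one_ne_zero (s, x)).hasFDerivAt.comp_hasDerivAt s
      ((hasDerivAt_id s).prodMk (hasDerivAt_const s x)) :)
  have hc : Continuous fun q : ℝ × V => deriv (fun s => F s q.2) q.1 := by
    have h := (hF.continuous_fderiv one_ne_zero).clm_apply
      (continuous_const (y := ((1, 0) : ℝ × V)))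
    exact h.congr fun q => ((hd q.1 q.2).deriv).symm
  obtain ⟨C, hC⟩ := ((isCompact_Icc (a := t - 1) (b := t + 1)).prod hK).exists_bound_of_continuousOn
    hc.continuousOn
  have hint : ∀ {g : V → ℝ}, Continuous g → IntegrableOn g K μ := fun hg =>
    hg.continuousOn.integrableOn_compact hK
  have hFc : ∀ s, Continuous (F s) := fun s => hF.continuous.comp (Continuous.prodMk_right s)
  refine (hasDerivAt_integral_of_dominated_loc_of_deriv_le (bound := fun _ => C)
    (F' := fun s x => deriv (fun s => F s x) s)
    (Icc_mem_nhds (sub_one_lt t) (lt_add_one t))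
    (.of_forall fun s => (hint (hFc s)).aestronglyMeasurable) (hint (hFc t))
    (hint (hc.comp (Continuous.prodMk_right t))).aestronglyMeasurable
    ?_ (hint continuous_const) (.of_forall fun x s _ => ?_)).2
  · exact ae_restrict_of_forall_mem hK.measurableSet fun x hx s hs => hC (s, x) ⟨hs, hx⟩
  · exact (hd s x).differentiableAt.hasDerivAt

/-- The divergence of a `C¹` vector field on the slice that is `2L`-periodic in `x` and tangent to
the lower and upper boundaries integrates to zero. -/
theorem setIntegral_Omega_divergence_eq_zero {L H : ℝ} (hL : 0 ≤ L) (hH : 0 ≤ H)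
    {g h : ℝ × ℝ → ℝ} (hg : ContDiff ℝ 1 g) (hh : ContDiff ℝ 1 h)
    (hper : ∀ x z, g (x + 2 * L, z) = g (x, z))
    (hbot : ∀ x, h (x, 0) = 0) (htop : ∀ x, h (x, H) = 0) :
    ∫ q in Omega L H, (pdx g q + pdz h q) = 0 := by
  have hle : ((-L, 0) : ℝ × ℝ) ≤ (L, H) := ⟨by simpa using by linarith, hH⟩
  have hcont : Continuous fun q => fderiv ℝ g q (1, 0) + fderiv ℝ h q (0, 1) :=
    ((hg.continuous_fderiv one_ne_zero).clm_apply continuous_const).add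
      ((hh.continuous_fderiv one_ne_zero).clm_apply continuous_const)
  have hdiv := integral_divergence_prod_Icc_of_hasFDerivAt_of_le g h (fderiv ℝ g) (fderiv ℝ h)
    (-L, 0) (L, H) hle hg.continuous.continuousOn hh.continuous.continuousOn
    (fun x _ => (hg.differentiable one_ne_zero x).hasFDerivAt)
    (fun x _ => (hh.differentiable one_ne_zero x).hasFDerivAt)
    (hcont.continuousOn.integrableOn_compact isCompact_Icc)
  have hside : ∀ z, g (L, z) = g (-L, z) := fun z => by
    rw [← hper (-L) z]; congr 2; ring
  simpa [pdx, pdz, Omega, hbot, htop, hside] using hdiv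

/-- For a smooth solution of the Eady–Boussinesq vertical slice equations on `Ω` for `t` in
an open interval `I = (a, c)`, the in-slice kinetic energy `K_u` is differentiable on `I`
with `dK_u/dt (t) = ρ₀ ∫_Ω (f v u₁ + b u₂) dx dz` for every `t ∈ I`. -/
theorem Ku_hasDerivAt (L H ρ₀ f N2 bY a c : ℝ) (hL : 0 < L) (hH : 0 < H) (hρ : 0 < ρ₀)
    (sol : EadySolution L H ρ₀ f N2 bY (Set.Ioo a c)) :
    ∀ t ∈ Set.Ioo a c,
      HasDerivAt (Ku L H ρ₀ sol.u)
        (ρ₀ * ∫ pt in Omega L H,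
          (f * sol.v t pt * (sol.u t pt).1 + sol.b t pt * (sol.u t pt).2)) t := by
  intro t ht
  have hslice : ContDiff ℝ 1 fun q : ℝ × ℝ => ((t, q) : ℝ × (ℝ × ℝ)) :=
    contDiff_const.prodMk contDiff_id
  have hu : ContDiff ℝ 1 fun q : ℝ × (ℝ × ℝ) => sol.u q.1 q.2 :=
    sol.smooth_u.of_le (by exact_mod_cast le_top)
  have hp : ContDiff ℝ 1 (sol.p t) :=
    (sol.smooth_p.of_le (by exact_mod_cast le_top)).comp hslice
  have hv : Continuous (sol.v t) := sol.smooth_v.continuous.comp hslice.continuous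
  have hb : Continuous (sol.b t) := sol.smooth_b.continuous.comp hslice.continuous
  have hu₁ : ContDiff ℝ 1 fun q => (sol.u t q).1 := (hu.comp hslice).fst
  have hu₂ : ContDiff ℝ 1 fun q => (sol.u t q).2 := (hu.comp hslice).snd
  have hE : ContDiff ℝ 1 fun q =>
      (1 / 2) * ((sol.u t q).1 ^ 2 + (sol.u t q).2 ^ 2) + (1 / ρ₀) * sol.p t q :=
    (contDiff_const.mul ((hu₁.pow 2).add (hu₂.pow 2))).add (contDiff_const.mul hp)
  have hg := hu₁.mul hE
  have hh := hu₂.mul hE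
  have hdiv := setIntegral_Omega_divergence_eq_zero hL.le hH.le hg hh
    (fun x z => by simp only [sol.periodic_u, sol.periodic_p])
    (fun x => by simp only [sol.rigid_bot, zero_mul])
    (fun x => by simp only [sol.rigid_top, zero_mul])
  have hdivc : Continuous fun q => pdx (fun q => (sol.u t q).1 *
        ((1 / 2) * ((sol.u t q).1 ^ 2 + (sol.u t q).2 ^ 2) + (1 / ρ₀) * sol.p t q)) q +
      pdz (fun q => (sol.u t q).2 *
        ((1 / 2) * ((sol.u t q).1 ^ 2 + (sol.u t q).2 ^ 2) + (1 / ρ₀) * sol.p t q)) q :=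
    ((hg.continuous_fderiv one_ne_zero).clm_apply continuous_const).add
      ((hh.continuous_fderiv one_ne_zero).clm_apply continuous_const)
  have hworkc : Continuous fun q =>
      f * sol.v t q * (sol.u t q).1 + sol.b t q * (sol.u t q).2 :=
    ((continuous_const.mul hv).mul hu₁.continuous).add (hb.mul hu₂.continuous)
  have hK : IsCompact (Omega L H) := isCompact_Icc
  have hderiv := hasDerivAt_setIntegral_of_contDiff (μ := volume) hK
    (F := fun s q => (1 / 2) * ((sol.u s q).1 ^ 2 + (sol.u s q).2 ^ 2))
    (contDiff_const.mul ((hu.fst.pow 2).add (hu.snd.pow 2))) t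
  refine (hderiv.const_mul ρ₀).congr_deriv ?_
  congr 1
  rw [← sub_zero (∫ q in Omega L H, (f * sol.v t q * (sol.u t q).1 + sol.b t q * (sol.u t q).2)),
    ← hdiv, ← integral_sub (hworkc.continuousOn.integrableOn_compact hK)
      (hdivc.continuousOn.integrableOn_compact hK)]
  refine setIntegral_congr_fun hK.measurableSet fun q hq => ?_
  have hut : DifferentiableAt ℝ (fun s => sol.u s q) t :=
    (hu.comp (contDiff_id.prodMk contDiff_const)).differentiable one_ne_zero t
  have hkin := (((hut.fst.hasDerivAt.pow 2).add (hut.snd.hasDerivAt.pow 2)).const_mul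
    (1 / 2 : ℝ)).deriv
  have d₁ := (hu₁.differentiable one_ne_zero q).hasFDerivAt
  have d₂ := (hu₂.differentiable one_ne_zero q).hasFDerivAt
  have dp := (hp.differentiable one_ne_zero q).hasFDerivAt
  have dE := (((d₁.pow 2).add (d₂.pow 2)).const_mul (1 / 2 : ℝ)).add (dp.const_mul (1 / ρ₀))
  have hx := congrArg (fun A => A (1, 0)) (d₁.mul dE).fderiv
  have hz := congrArg (fun A => A (0, 1)) (d₂.mul dE).fderiv
  have mx := sol.mom_x t ht q hq
  have mz := sol.mom_z t ht q hq
  have hinc := sol.incomp t ht q hq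
  simp only [pdx, pdz] at mx mz hinc ⊢
  refine hkin.trans (Eq.trans ?_ (congrArg₂ (fun x y => _ - (x + y)) hx hz).symm)
  simp only [Nat.cast_ofNat, Nat.add_one_sub_one, pow_one, nsmul_eq_mul, Pi.add_apply,
    add_apply, smul_apply, smul_eq_mul]
  linear_combination (sol.u t q).1 * mx + (sol.u t q).2 * mz +
    ((1 / 2) * ((sol.u t q).1 ^ 2 + (sol.u t q).2 ^ 2) + (1 / ρ₀) * sol.p t q) * hinc
end

section
/- Let L, H > 0 and constants ρ₀ > 0, θ₀ > 0, g, f, Λ, N². Define the background profiles θ̄(y, z) = (θ₀/g)(−f Λ y + N² z) and p̄(y, z) = −ρ₀ f Λ y (z − H/2) + ½ ρ₀ N² z². Suppose the smooth fields (u₁, u₂, v, b, p), functions of (x, z, t) on [−L, L] × [0, H], satisfy the Eady–Boussinesq vertical slice equations with b̄_y = −f Λ. Define three-dimensional fields on [−L, L] × ℝ × [0, H] by U(x, y, z, t) = (u₁(x, z, t), v(x, z, t), u₂(x, z, t)), Θ(x, y, z, t) = θ̄(y, z) + (θ₀/g) b(x, z, t), and P₃(x, y, z, t) = p̄(y, z)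 + p(x, z, t). Then (U, Θ, P₃) satisfies the three-dimensional incompressible Euler–Boussinesq equations: ∂U/∂t + (U·∇₃)U + f ẑ×U = −(1/ρ₀)∇₃P₃ + (g/θ₀) Θ ẑ, ∂Θ/∂t + U·∇₃Θ = 0, ∇₃·U = 0, where ∇₃ = (∂ₓ, ∂_y, ∂_z) and ẑ×U = (−U₂, U₁, 0) for U = (U₁, U₂, U₃). -/
/-- A solution of the Eady–Boussinesq vertical slice equations (with background buoyancy
gradient `b̄_y = −fΛ`), extended by the background profiles
`θ̄(y,z) = (θ₀/g)(−fΛy + N²z)` and `p̄(y,z) = −ρ₀fΛy(z − H/2) + ½ρ₀N²z²`, yields a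
solution `(U, Θ, P₃)` of the three-dimensional incompressible Euler–Boussinesq equations
on `[−L,L] × ℝ × [0,H]`:
`∂U/∂t + (U·∇₃)U + f ẑ×U = −(1/ρ₀)∇₃P₃ + (g/θ₀)Θ ẑ`, `∂Θ/∂t + U·∇₃Θ = 0`, `∇₃·U = 0`,
where `U = (u₁, v, u₂)`, `Θ = θ̄ + (θ₀/g) b`, `P₃ = p̄ + p`. -/
theorem slice_solution_is_threeD_solution
    (L H ρ₀ θ₀ g f Λ N2 : ℝ) (hL : 0 < L) (hH : 0 < H) (hρ : 0 < ρ₀) (hθ : 0 < θ₀)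
    (hg : g ≠ 0)
    (u₁ u₂ v b p : ℝ → ℝ → ℝ → ℝ)
    (hsu₁ : ContDiff ℝ (⊤ : ℕ∞) fun q : ℝ × ℝ × ℝ => u₁ q.1 q.2.1 q.2.2)
    (hsu₂ : ContDiff ℝ (⊤ : ℕ∞) fun q : ℝ × ℝ × ℝ => u₂ q.1 q.2.1 q.2.2)
    (hsv : ContDiff ℝ (⊤ : ℕ∞) fun q : ℝ × ℝ × ℝ => v q.1 q.2.1 q.2.2)
    (hsb : ContDiff ℝ (⊤ : ℕ∞) fun q : ℝ × ℝ × ℝ => b q.1 q.2.1 q.2.2)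
    (hsp : ContDiff ℝ (⊤ : ℕ∞) fun q : ℝ × ℝ × ℝ => p q.1 q.2.1 q.2.2)
    -- the Eady–Boussinesq vertical slice equations with b̄_y = −fΛ :
    (hmom₁ : ∀ t : ℝ, ∀ x ∈ Set.Icc (-L) L, ∀ z ∈ Set.Icc 0 H,
      deriv (fun s => u₁ x z s) t + u₁ x z t * deriv (fun x' => u₁ x' z t) x
        + u₂ x z t * deriv (fun z' => u₁ x z' t) z - f * v x z t
      = -(1 / ρ₀) * deriv (fun x' => p x' z t) x)
    (hmom₂ : ∀ t : ℝ, ∀ x ∈ Set.Icc (-L) L, ∀ z ∈ Set.Icc 0 H,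
      deriv (fun s => u₂ x z s) t + u₁ x z t * deriv (fun x' => u₂ x' z t) x
        + u₂ x z t * deriv (fun z' => u₂ x z' t) z
      = -(1 / ρ₀) * deriv (fun z' => p x z' t) z + b x z t)
    (hmomv : ∀ t : ℝ, ∀ x ∈ Set.Icc (-L) L, ∀ z ∈ Set.Icc 0 H,
      deriv (fun s => v x z s) t + u₁ x z t * deriv (fun x' => v x' z t) x
        + u₂ x z t * deriv (fun z' => v x z' t) z + f * u₁ x z t
      = -(-(f * Λ)) * (z - H / 2))
    (hbuoy : ∀ t : ℝ, ∀ x ∈ Set.Icc (-L) L, ∀ z ∈ Set.Icc 0 H,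
      deriv (fun s => b x z s) t + u₁ x z t * deriv (fun x' => b x' z t) x
        + u₂ x z t * deriv (fun z' => b x z' t) z
        + (-(f * Λ)) * v x z t + N2 * u₂ x z t = 0)
    (hdiv : ∀ t : ℝ, ∀ x ∈ Set.Icc (-L) L, ∀ z ∈ Set.Icc 0 H,
      deriv (fun x' => u₁ x' z t) x + deriv (fun z' => u₂ x z' t) z = 0)
    -- the three-dimensional fields :
    (U₁ U₂ U₃ Θ P₃ : ℝ → ℝ → ℝ → ℝ → ℝ)
    (hU₁ : U₁ = fun x _y z t => u₁ x z t)
    (hU₂ : U₂ = fun x _y z t => v x z t)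
    (hU₃ : U₃ = fun x _y z t => u₂ x z t)
    (hΘ : Θ = fun x y z t => (θ₀ / g) * (-(f * Λ * y) + N2 * z) + (θ₀ / g) * b x z t)
    (hP₃ : P₃ = fun x y z t =>
      (-(ρ₀ * f * Λ * y * (z - H / 2)) + (1 / 2) * ρ₀ * N2 * z ^ 2) + p x z t) :
    ∀ t : ℝ, ∀ x ∈ Set.Icc (-L) L, ∀ y : ℝ, ∀ z ∈ Set.Icc 0 H,
      -- x̂-component of the momentum equation
      (deriv (fun s => U₁ x y z s) t
          + U₁ x y z t * deriv (fun x' => U₁ x' y z t) x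
          + U₂ x y z t * deriv (fun y' => U₁ x y' z t) y
          + U₃ x y z t * deriv (fun z' => U₁ x y z' t) z
          - f * U₂ x y z t
        = -(1 / ρ₀) * deriv (fun x' => P₃ x' y z t) x) ∧
      -- ŷ-component of the momentum equation
      (deriv (fun s => U₂ x y z s) t
          + U₁ x y z t * deriv (fun x' => U₂ x' y z t) x
          + U₂ x y z t * deriv (fun y' => U₂ x y' z t) y
          + U₃ x y z t * deriv (fun z' => U₂ x y z' t) z
          + f * U₁ x y z t
        = -(1 / ρ₀) * deriv (fun y' => P₃ x y' z t) y) ∧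
      -- ẑ-component of the momentum equation
      (deriv (fun s => U₃ x y z s) t
          + U₁ x y z t * deriv (fun x' => U₃ x' y z t) x
          + U₂ x y z t * deriv (fun y' => U₃ x y' z t) y
          + U₃ x y z t * deriv (fun z' => U₃ x y z' t) z
        = -(1 / ρ₀) * deriv (fun z' => P₃ x y z' t) z + (g / θ₀) * Θ x y z t) ∧
      -- potential temperature equation
      (deriv (fun s => Θ x y z s) t
          + U₁ x y z t * deriv (fun x' => Θ x' y z t) x
          + U₂ x y z t * deriv (fun y' => Θ x y' z t) y
          + U₃ x y z t * deriv (fun z' => Θ x y z' t) z = 0) ∧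
      -- incompressibility
      (deriv (fun x' => U₁ x' y z t) x + deriv (fun y' => U₂ x y' z t) y
          + deriv (fun z' => U₃ x y z' t) z = 0) := by
  intro t x hx y z hz
  subst hU₁ hU₂ hU₃ hΘ hP₃
  have hbz : DifferentiableAt ℝ (fun z' => b x z' t) z :=
    ((hsb.differentiable (by simp)).comp
      (g := fun q : ℝ × ℝ × ℝ => b q.1 q.2.1 q.2.2)
      (f := fun z' : ℝ => (x, z', t)) (by fun_prop)) z
  have hpz : DifferentiableAt ℝ (fun z' => p x z' t) z :=
    ((hsp.differentiable (by simp)).comp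
      (g := fun q : ℝ × ℝ × ℝ => p q.1 q.2.1 q.2.2)
      (f := fun z' : ℝ => (x, z', t)) (by fun_prop)) z
  have hPy : deriv (fun y' => (-(ρ₀ * f * Λ * y' * (z - H / 2)) + (1 / 2) * ρ₀ * N2 * z ^ 2)
      + p x z t) y = -(ρ₀ * f * Λ * (z - H / 2)) := by
    have h := (((((hasDerivAt_id' y).const_mul (ρ₀ * f * Λ)).mul_const (z - H / 2)).fun_neg.add_const
      ((1 / 2) * ρ₀ * N2 * z ^ 2)).add_const (p x z t)).deriv
    rw [h, mul_one]
  have hPz : deriv (fun z' => (-(ρ₀ * f * Λ * y * (z' - H / 2)) + (1 / 2) * ρ₀ * N2 * z' ^ 2)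
      + p x z' t) z = -(ρ₀ * f * Λ * y) + ρ₀ * N2 * z + deriv (fun z' => p x z' t) z := by
    have h := (((((hasDerivAt_id' z).sub_const (H / 2)).const_mul (ρ₀ * f * Λ * y)).fun_neg.fun_add
      ((hasDerivAt_pow 2 z).const_mul ((1 / 2) * ρ₀ * N2))).fun_add hpz.hasDerivAt).deriv
    rw [h]
    norm_num
    ring
  have hΘy : deriv (fun y' => (θ₀ / g) * (-(f * Λ * y') + N2 * z) + (θ₀ / g) * b x z t) y
      = (θ₀ / g) * -(f * Λ) := by
    have h := (((((hasDerivAt_id' y).const_mul (f * Λ)).fun_neg.add_const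
      (N2 * z)).const_mul (θ₀ / g)).add_const ((θ₀ / g) * b x z t)).deriv
    rw [h, mul_one]
  have hΘz : deriv (fun z' => (θ₀ / g) * (-(f * Λ * y) + N2 * z') + (θ₀ / g) * b x z' t) z
      = (θ₀ / g) * N2 + (θ₀ / g) * deriv (fun z' => b x z' t) z := by
    have h := (((((hasDerivAt_id' z).const_mul N2).const_add (-(f * Λ * y))).const_mul
      (θ₀ / g)).fun_add (hbz.hasDerivAt.const_mul (θ₀ / g))).deriv
    rw [h, mul_one]
  simp only [hPy, hPz, hΘy, hΘz, deriv_const, deriv_const_add', deriv_const_mul_field]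
  refine ⟨?_, ?_, ?_, ?_, ?_⟩
  · linear_combination hmom₁ t x hx z hz
  · have hρ' : -(1 / ρ₀) * -(ρ₀ * f * Λ * (z - H / 2)) = f * Λ * (z - H / 2) := by
      field_simp
    rw [hρ']
    linear_combination hmomv t x hx z hz
  · have hρ' : -(1 / ρ₀) * (-(ρ₀ * f * Λ * y) + ρ₀ * N2 * z + deriv (fun z' => p x z' t) z)
        = f * Λ * y - N2 * z - (1 / ρ₀) * deriv (fun z' => p x z' t) z := by
      field_simp
      ring
    have hθ' : (g / θ₀) * ((θ₀ / g) * (-(f * Λ * y) + N2 * z) + (θ₀ / g) * b x z t)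
        = -(f * Λ * y) + N2 * z + b x z t := by
      field_simp
    rw [hρ', hθ']
    linear_combination hmom₂ t x hx z hz
  · linear_combination (θ₀ / g) * hbuoy t x hx z hz
  · linear_combination hdiv t x hx z hz
end
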